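/- arXiv:2410.20312 — 5 statements merged into one kernel-verified Lean document; each statement's English description precedes it below -/
import Mathlib

section
/- Let n ≥ 2, let g : ℝ → ℝ be differentiable, let x : Fin n → ℝ, and fix i ∈ Fin n. Then the function t ↦ V(Function.update x i t) is differentiable at t = x i, with derivative equal to (2/(n(n−1)))·g'(x i)·((n−1)·g(x i) − ∑_{j ≠ i} g(x j)). -/
/-- The sample variance `V(x) = (1/(n-1)) ∑ i (g (x i) - (1/n) ∑ j g (x j))²` of the transformed
points `g (x i)`. -/
noncomputable def sampleVar (n : ℕ) (g : ℝ → ℝ) (x : Fin n → ℝ) : ℝ :=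
  (1 / ((n : ℝ) - 1)) * ∑ i, (g (x i) - (1 / (n : ℝ)) * ∑ j, g (x j)) ^ 2

/-- The sample variance in terms of the sums of the values and of their squares. -/
theorem sampleVar_eq_sum_sq_sub (n : ℕ) (hn : n ≠ 0) (g : ℝ → ℝ) (x : Fin n → ℝ) :
    sampleVar n g x =
      1 / ((n : ℝ) - 1) * (∑ j, g (x j) ^ 2 - 1 / (n : ℝ) * (∑ j, g (x j)) ^ 2) := by
  have hn' : (n : ℝ) ≠ 0 := Nat.cast_ne_zero.mpr hn
  unfold sampleVar
  congr 1
  simp only [sub_sq, Finset.sum_add_distrib, Finset.sum_sub_distrib, ← Finset.sum_mul,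
    ← Finset.mul_sum, Finset.sum_const, Finset.card_univ, Fintype.card_fin, nsmul_eq_mul]
  field_simp
  ring

/-- Replacing the `i`-th entry changes only the `i`-th term of a sum. -/
theorem sum_comp_update {ι α M : Type*} [Fintype ι] [DecidableEq ι] [AddCommMonoid M]
    (f : α → M) (x : ι → α) (i : ι) (t : α) :
    ∑ j, f (Function.update x i t j) = f t + ∑ j ∈ Finset.univ.erase i, f (x j) := by
  rw [← Finset.add_sum_erase _ _ (Finset.mem_univ i), Function.update_self]
  congr 1
  refine Finset.sum_congr rfl fun j hj => ?_
  rw [Function.update_of_ne (Finset.ne_of_mem_erase hj)]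

/-- Eq. B.6 of the QDQ paper: for `n ≥ 2`, a differentiable `g : ℝ → ℝ`, `x : Fin n → ℝ` and a
fixed index `i`, the map `t ↦ V(update x i t)` is differentiable at `t = x i` with derivative
`(2/(n(n-1))) g'(x i) ((n-1) g(x i) - ∑_{j ≠ i} g(x j))`. -/
theorem sampleVar_hasDerivAt (n : ℕ) (hn : 2 ≤ n) (g : ℝ → ℝ) (hg : Differentiable ℝ g)
    (x : Fin n → ℝ) (i : Fin n) :
    HasDerivAt (fun t : ℝ => sampleVar n g (Function.update x i t))
      ((2 / ((n : ℝ) * ((n : ℝ) - 1))) * deriv g (x i) *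
        (((n : ℝ) - 1) * g (x i) - ∑ j ∈ Finset.univ.erase i, g (x j)))
      (x i) := by
  have hn0 : (n : ℝ) ≠ 0 := Nat.cast_ne_zero.mpr (by omega)
  have hn1 : (n : ℝ) - 1 ≠ 0 := by
    have : (2 : ℝ) ≤ n := by exact_mod_cast hn
    linarith
  simp only [sampleVar_eq_sum_sq_sub n (by omega) g, sum_comp_update g x i,
    sum_comp_update (fun y => g y ^ 2) x i]
  have hd := (hg (x i)).hasDerivAt
  refine ((((hd.pow 2).add_const (∑ j ∈ Finset.univ.erase i, g (x j) ^ 2)).sub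
    (((hd.add_const (∑ j ∈ Finset.univ.erase i, g (x j))).pow 2).const_mul
      (1 / (n : ℝ)))).const_mul (1 / ((n : ℝ) - 1))).congr_deriv ?_
  field_simp
  ring
end

section
/- Let n ≥ 2 and L ≥ 0. Let g : ℝ × ℝ → ℝ be such that for every t the map y ↦ g(y,t) is L-Lipschitz, and for every y the map t ↦ g(y,t) is differentiable with |∂_t g(y,t)| ≤ L for all t. Fix x : Fin n → ℝ and j ∈ Fin n, and define e_j(t) = (g(x j, t) − (1/n)·∑_{i=1}^n g(x i, t))². Then e_j is differentiable and |e_j'(t)| ≤ (4·L²/n)·∑_{i=1}^n |x j − x i| for every t. -/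
/-- The deviation of a sample from the mean is at most its mean distance to the samples. -/
theorem abs_sub_mean_le {n : ℕ} (a : Fin n → ℝ) (j : Fin n) :
    |a j - (1 / (n : ℝ)) * ∑ i, a i| ≤ (1 / (n : ℝ)) * ∑ i, |a j - a i| := by
  have hn : (n : ℝ) ≠ 0 := Nat.cast_ne_zero.mpr (Fin.pos j).ne'
  have h : a j - (1 / (n : ℝ)) * ∑ i, a i = (1 / (n : ℝ)) * ∑ i, (a j - a i) := by
    rw [Finset.sum_sub_distrib, Finset.sum_const, Finset.card_univ, Fintype.card_fin,
      nsmul_eq_mul]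
    field_simp
  rw [h, abs_mul, abs_of_nonneg (by positivity : (0 : ℝ) ≤ 1 / n)]
  gcongr
  exact Finset.abs_sum_le_sum_abs _ _

/-- Eq. B.10 of the QDQ paper (deterministic core of Theorem 2, parts (2) and (3)): let
`g : ℝ × ℝ → ℝ` be `L`-Lipschitz in its first argument (for each fixed `t`) and differentiable in
its second argument with `|∂ₜ g(y,t)| ≤ L`. For `x : Fin n → ℝ` and a fixed index `j`, the squared
deviation `e_j(t) = (g (x j, t) - (1/n) ∑ i g (x i, t))²` is differentiable, and its derivative is
bounded in absolute value by `(4 L² / n) ∑ i |x j - x i|`. -/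
theorem squared_deviation_deriv_bound (n : ℕ) (hn : 2 ≤ n) (L : ℝ) (hL : 0 ≤ L)
    (g : ℝ × ℝ → ℝ)
    (hgLip : ∀ t : ℝ, LipschitzWith (Real.toNNReal L) (fun y => g (y, t)))
    (hgDiff : ∀ y : ℝ, Differentiable ℝ (fun t => g (y, t)))
    (hgDerivBound : ∀ y t : ℝ, |deriv (fun t => g (y, t)) t| ≤ L)
    (x : Fin n → ℝ) (j : Fin n) :
    Differentiable ℝ (fun t : ℝ => (g (x j, t) - (1 / (n : ℝ)) * ∑ i, g (x i, t)) ^ 2) ∧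
      ∀ t : ℝ,
        |deriv (fun t : ℝ => (g (x j, t) - (1 / (n : ℝ)) * ∑ i, g (x i, t)) ^ 2) t| ≤
          (4 * L ^ 2 / (n : ℝ)) * ∑ i, |x j - x i| := by
  have hderiv (t : ℝ) := (((hgDiff (x j) t).hasDerivAt).sub
    ((HasDerivAt.fun_sum fun i (_ : i ∈ Finset.univ) =>
      (hgDiff (x i) t).hasDerivAt).const_mul (1 / (n : ℝ)))).fun_pow 2
  refine ⟨fun t => (hderiv t).differentiableAt, fun t => ?_⟩
  have hn0 : (n : ℝ) ≠ 0 := by positivity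
  have hdev : |g (x j, t) - (1 / (n : ℝ)) * ∑ i, g (x i, t)| ≤
      (1 / (n : ℝ)) * ∑ i, L * |x j - x i| := by
    refine (abs_sub_mean_le (fun i => g (x i, t)) j).trans ?_
    gcongr with i
    simpa [Real.dist_eq, hL] using (hgLip t).dist_le_mul (x j) (x i)
  have hdev' : |deriv (fun t => g (x j, t)) t -
      (1 / (n : ℝ)) * ∑ i, deriv (fun t => g (x i, t)) t| ≤ 2 * L := by
    refine (abs_sub_mean_le (fun i => deriv (fun t => g (x i, t)) t) j).trans ?_
    calc _ ≤ (1 / (n : ℝ)) * ∑ _i : Fin n, 2 * L := by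
          gcongr with i
          exact (abs_sub _ _).trans
            (by linarith [hgDerivBound (x j) t, hgDerivBound (x i) t])
      _ = 2 * L := by
          simp only [Finset.sum_const, Finset.card_univ, Fintype.card_fin, nsmul_eq_mul]
          field_simp
  refine (congrArg abs (hderiv t).deriv).trans_le ?_
  simp only [Pi.sub_apply, Nat.cast_ofNat, Nat.add_one_sub_one, pow_one, abs_mul, abs_two]
  calc _ ≤ 2 * ((1 / (n : ℝ)) * ∑ i, L * |x j - x i|) * (2 * L) := by gcongr
    _ = (4 * L ^ 2 / (n : ℝ)) * ∑ i, |x j - x i| := by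
        rw [← Finset.mul_sum]
        ring
end

section
/- Let n ≥ 2 and v > 0, and let μ be the product measure on (Fin n → ℝ) whose factors are all the Gaussian measure N(0,v). Fix i ∈ Fin n. Then μ({x : ∃ j, 2·√(2·v·log n) < |x i − x j|}) ≤ 2/n. -/
open ProbabilityTheory MeasureTheory

/-- A centered Gaussian random variable is sub-Gaussian with parameter its variance. -/
lemma hasSubgaussianMGF_of_map_eq_gaussianReal {Ω : Type*} {mΩ : MeasurableSpace Ω} {μ : Measure Ω}
    {X : Ω → ℝ} {v : NNReal} (hX : AEMeasurable X μ) (h : μ.map X = gaussianReal 0 v) :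
    HasSubgaussianMGF X v μ := by
  refine HasSubgaussianMGF.of_map (X := id) hX ?_
  rw [h]
  exact ⟨integrable_exp_mul_gaussianReal, fun t => by simp [mgf_id_gaussianReal]⟩

/-- The two-sided Chernoff bound for a sub-Gaussian random variable. -/
lemma measureReal_abs_ge_le_of_hasSubgaussianMGF {Ω : Type*} {mΩ : MeasurableSpace Ω} {μ : Measure Ω}
    {X : Ω → ℝ} {c : NNReal} [IsFiniteMeasure μ] (h : HasSubgaussianMGF X c μ) {ε : ℝ}
    (hε : 0 ≤ ε) :
    μ.real {ω | ε ≤ |X ω|} ≤ 2 * Real.exp (-ε ^ 2 / (2 * c)) := by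
  have hsub : {ω | ε ≤ |X ω|} = {ω | ε ≤ X ω} ∪ {ω | ε ≤ (-X) ω} := by
    ext ω
    simp [le_abs]
  rw [hsub]
  linarith [measureReal_union_le (μ := μ) {ω | ε ≤ X ω} {ω | ε ≤ (-X) ω},
    h.measure_ge_le hε, h.neg.measure_ge_le hε]

/-- The difference of two distinct coordinates of an i.i.d. `N(0, v)` vector is sub-Gaussian with
parameter `2v`. -/
lemma hasSubgaussianMGF_sub_pi_gaussianReal {ι : Type*} [Fintype ι] (v : NNReal) {i j : ι}
    (hij : i ≠ j) :
    HasSubgaussianMGF (fun x : ι → ℝ => x i - x j) (v + v)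
      (Measure.pi fun _ : ι => gaussianReal 0 v) := by
  have hcoord (k : ι) : HasSubgaussianMGF (fun x : ι → ℝ => x k) v
      (Measure.pi fun _ : ι => gaussianReal 0 v) :=
    hasSubgaussianMGF_of_map_eq_gaussianReal (measurable_pi_apply k).aemeasurable
      (measurePreserving_eval (fun _ : ι => gaussianReal 0 v) k).map_eq
  have hindep : iIndepFun (fun (k : ι) (x : ι → ℝ) => x k)
      (Measure.pi fun _ : ι => gaussianReal 0 v) :=
    iIndepFun_pi (X := fun _ => id) fun _ => aemeasurable_id
  exact (hcoord i).sub_of_indepFun (hcoord j) (hindep.indepFun hij)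

/-- Probabilistic step in Theorem 2 of the QDQ paper: if `x₁, …, xₙ` are i.i.d. samples from the
Gaussian measure `N(0, v)` with `v > 0` and `n ≥ 2`, then with probability at least `1 - 2/n` all
gaps `|x i - x j|` from a fixed coordinate `i` are at most `2 √(2 v log n)`; i.e. the probability
that some gap exceeds this threshold is at most `2/n`. -/
theorem gaussian_pairwise_gap_bound (n : ℕ) (hn : 2 ≤ n) (v : NNReal) (hv : 0 < v) (i : Fin n) :
    Measure.pi (fun _ : Fin n => gaussianReal 0 v)
        {x : Fin n → ℝ | ∃ j : Fin n, 2 * Real.sqrt (2 * v * Real.log n) < |x i - x j|} ≤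
      ENNReal.ofReal (2 / n) := by
  set P := Measure.pi (fun _ : Fin n => gaussianReal 0 v)
  set t := 2 * Real.sqrt (2 * v * Real.log n) with ht
  have hn0 : (0 : ℝ) < n := by positivity
  have hv0 : (0 : ℝ) < v := hv
  have ht0 : 0 ≤ t := by positivity
  have htail : Real.exp (-t ^ 2 / (2 * (v + v : NNReal))) = 1 / (n : ℝ) ^ 2 := by
    have hsq : t ^ 2 = 8 * v * Real.log n := by
      rw [ht, mul_pow, Real.sq_sqrt (by positivity)]
      ring
    have hexp : -t ^ 2 / (2 * (v + v : NNReal)) = -(2 * Real.log n) := by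
      rw [hsq]
      push_cast
      field_simp
      ring
    rw [hexp, Real.exp_neg, mul_comm, Real.exp_mul, Real.exp_log hn0, one_div]
    norm_cast
  have hgap (j : Fin n) : P.real {x | t < |x i - x j|} ≤ 2 / (n : ℝ) ^ 2 := by
    rcases eq_or_ne i j with rfl | hij
    · simp only [sub_self, abs_zero, not_lt.2 ht0, Set.ofPred_false, measureReal_empty]
      positivity
    · calc P.real {x | t < |x i - x j|} ≤ P.real {x | t ≤ |x i - x j|} :=
            measureReal_mono fun x (hx : t < |x i - x j|) => hx.le
        _ ≤ 2 * Real.exp (-t ^ 2 / (2 * (v + v : NNReal))) :=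
            measureReal_abs_ge_le_of_hasSubgaussianMGF
              (hasSubgaussianMGF_sub_pi_gaussianReal v hij) ht0
        _ = 2 / (n : ℝ) ^ 2 := by rw [htail, mul_one_div]
  rw [← ofReal_measureReal, Set.ofPred_exists]
  refine ENNReal.ofReal_le_ofReal ?_
  calc P.real (⋃ j, {x | t < |x i - x j|}) ≤ ∑ j, P.real {x | t < |x i - x j|} :=
        measureReal_iUnion_fintype_le _
    _ ≤ ∑ _j : Fin n, 2 / (n : ℝ) ^ 2 := Finset.sum_le_sum fun j _ => hgap j
    _ = 2 / n := by
        rw [Finset.sum_const, Finset.card_univ, Fintype.card_fin, nsmul_eq_mul]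
        field_simp
end

section
/- Let X be a type, U ⊆ X a set, H : X → ℝ, and α, β ∈ [0,1] with H(x) > 0 and 1 ≤ β·H(x) for every x ∈ U. For Q : X → ℝ define G_Q(x) = α·Q(x) + (1−α)·(Q(x)/H(x) if x ∈ U, else β·Q(x)). Then for all Q, Q' : X → ℝ and all x ∈ X: |G_Q(x) − G_{Q'}(x)| ≤ (α + (1−α)·β)·|Q(x) − Q'(x)|. -/
open Classical in
/-- The blended (uncertainty-penalized) target of QDQ: on the high-uncertainty set `U` the
Q-value is weighted by `1/H`, and off `U` it is weighted by `β`, mixed with the unpenalized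
value with weight `α`. -/
noncomputable def blendedTarget {X : Type*} (U : Set X) (H : X → ℝ) (α β : ℝ)
    (Q : X → ℝ) (x : X) : ℝ :=
  α * Q x + (1 - α) * (if x ∈ U then Q x / H x else β * Q x)

/-- Eq. C.8 of the QDQ paper (core inequality of Theorem 3): if `α, β ∈ [0,1]`, `H > 0` on `U`
and `1 ≤ β H` on `U`, then the blended target is a pointwise contraction with constant
`α + (1 - α) β`. -/
theorem blendedTarget_pointwise_contraction {X : Type*} (U : Set X) (H : X → ℝ) (α β : ℝ)
    (hα : α ∈ Set.Icc (0 : ℝ) 1) (hβ : β ∈ Set.Icc (0 : ℝ) 1)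
    (hH : ∀ x ∈ U, 0 < H x) (hβH : ∀ x ∈ U, 1 ≤ β * H x) (Q Q' : X → ℝ) (x : X) :
    |blendedTarget U H α β Q x - blendedTarget U H α β Q' x| ≤
      (α + (1 - α) * β) * |Q x - Q' x| := by
  obtain ⟨hα₀, hα₁⟩ := hα
  obtain ⟨w, hw₀, hwβ, hw⟩ : ∃ w, 0 ≤ w ∧ w ≤ β ∧
      ∀ R : X → ℝ, blendedTarget U H α β R x = (α + (1 - α) * w) * R x := by
    by_cases hx : x ∈ U
    · refine ⟨1 / H x, (one_div_pos.2 (hH x hx)).le, (div_le_iff₀ (hH x hx)).2 (hβH x hx), ?_⟩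
      intro R
      simp only [blendedTarget, if_pos hx]
      ring
    · refine ⟨β, hβ.1, le_rfl, ?_⟩
      intro R
      simp only [blendedTarget, if_neg hx]
      ring
  have h₁ : 0 ≤ 1 - α := sub_nonneg.2 hα₁
  have h₂ : 0 ≤ α + (1 - α) * w := by positivity
  rw [hw, hw, ← mul_sub, abs_mul, abs_of_nonneg h₂]
  gcongr
end

section
/- Let S and A be nonempty measurable spaces, r : S × A → ℝ, γ ∈ (0,1), and κ a Markov kernel from S × A to S. Let α, β ∈ [0,1], U ⊆ S × A, and H : S × A → ℝ with H(x) > 0 and 1 ≤ β·H(x) for every x ∈ U. Let Q, Q' : S × A → ℝ be bounded by M (i.e., |Q(x)| ≤ M and |Q'(x)| ≤ M for all x), and suppose that for every (s,a) the functions s' ↦ ⨆_{a' ∈ A} G_Q(s',a') and s' ↦ ⨆_{a' ∈ A} G_{Q'}(s',a') are integrable with respect to κ(s,a). Then for every (s,a): |𝓕Q(s,a) − 𝓕Q'(s,a)| ≤ (α + (1−α)·β)·γ·⨆_{x ∈ S×A} |Q(x) − Q'(x)|. In particular, when β < 1 or α < 1 combined with γ < 1, 𝓕 is a contraction in the sup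 norm with constant (α + (1−α)β)·γ < 1. -/
open MeasureTheory ProbabilityTheory

/-- The QDQ Bellman operator
`(𝓕Q)(s,a) = r(s,a) + γ ∫ (⨆ a', G_Q(s',a')) dκ(s,a)(s')`, where `G_Q` is the blended target. -/
noncomputable def qdqBellman {S A : Type*} [MeasurableSpace S] [MeasurableSpace A]
    (r : S × A → ℝ) (γ : ℝ) (κ : Kernel (S × A) S) (U : Set (S × A)) (H : S × A → ℝ)
    (α β : ℝ) (Q : S × A → ℝ) (p : S × A) : ℝ :=
  r p + γ * ∫ s', (⨆ a' : A, blendedTarget U H α β Q (s', a')) ∂(κ p)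

/-- The classical (optimal) Bellman operator
`(𝓑Q)(s,a) = r(s,a) + γ ∫ (⨆ a', Q(s',a')) dκ(s,a)(s')`. -/
noncomputable def classicalBellman {S A : Type*} [MeasurableSpace S] [MeasurableSpace A]
    (r : S × A → ℝ) (γ : ℝ) (κ : Kernel (S × A) S) (Q : S × A → ℝ) (p : S × A) : ℝ :=
  r p + γ * ∫ s', (⨆ a' : A, Q (s', a')) ∂(κ p)

/-- The blended target is Lipschitz in the Q-value, with constant `α + (1 - α) * β`. -/
theorem abs_blendedTarget_sub_le {X : Type*} {U : Set X} {H : X → ℝ} {α β : ℝ}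
    (hα : α ∈ Set.Icc (0 : ℝ) 1) (hβ : 0 ≤ β) (hH : ∀ x ∈ U, 0 < H x)
    (hβH : ∀ x ∈ U, 1 ≤ β * H x) (Q Q' : X → ℝ) (x : X) :
    |blendedTarget U H α β Q x - blendedTarget U H α β Q' x| ≤
      (α + (1 - α) * β) * |Q x - Q' x| := by
  obtain ⟨w, hw, hwβ, hG⟩ : ∃ w : ℝ, 0 ≤ w ∧ w ≤ β ∧
      ∀ R : X → ℝ, blendedTarget U H α β R x = (α + (1 - α) * w) * R x := by
    by_cases hx : x ∈ U
    · refine ⟨(H x)⁻¹, (inv_pos.2 (hH x hx)).le, ?_, fun R => ?_⟩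
      · rw [← one_div, div_le_iff₀ (hH x hx)]
        exact hβH x hx
      · simp only [blendedTarget, hx, if_true]
        ring
    · refine ⟨β, hβ, le_rfl, fun R => ?_⟩
      simp only [blendedTarget, hx, if_false]
      ring
  have hα' : 0 ≤ 1 - α := sub_nonneg.2 hα.2
  have hα₀ : 0 ≤ α := hα.1
  rw [hG, hG, ← mul_sub, abs_mul, abs_of_nonneg (by positivity)]
  gcongr

/-- The blended target of a bounded function is bounded. -/
theorem abs_blendedTarget_le {X : Type*} {U : Set X} {H : X → ℝ} {α β : ℝ}
    (hα : α ∈ Set.Icc (0 : ℝ) 1) (hβ : 0 ≤ β) (hH : ∀ x ∈ U, 0 < H x)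
    (hβH : ∀ x ∈ U, 1 ≤ β * H x) (Q : X → ℝ) (x : X) :
    |blendedTarget U H α β Q x| ≤ (α + (1 - α) * β) * |Q x| := by
  simpa [blendedTarget] using abs_blendedTarget_sub_le hα hβ hH hβH Q 0 x

/-- Suprema of two bounded families that are uniformly `c`-close are `c`-close. -/
theorem abs_ciSup_sub_ciSup_le {ι : Type*} [Nonempty ι] {f g : ι → ℝ} {c : ℝ}
    (hf : BddAbove (Set.range f)) (hg : BddAbove (Set.range g))
    (h : ∀ i, |f i - g i| ≤ c) : |(⨆ i, f i) - ⨆ i, g i| ≤ c := by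
  have hfg : (⨆ i, f i) ≤ (⨆ i, g i) + c := ciSup_le fun i => by
    linarith [le_ciSup hg i, (abs_le.1 (h i)).2]
  have hgf : (⨆ i, g i) ≤ (⨆ i, f i) + c := ciSup_le fun i => by
    linarith [le_ciSup hf i, (abs_le.1 (h i)).1]
  rw [abs_le]
  constructor <;> linarith

/-- Theorem 3 of the QDQ paper (contraction of the QDQ Bellman operator): under the stated
hypotheses, for every `(s,a)` we have
`|𝓕Q(s,a) - 𝓕Q'(s,a)| ≤ (α + (1-α)β) γ ⨆ x, |Q x - Q' x|`; in particular `𝓕` is a sup-norm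
contraction with constant `(α + (1-α)β) γ < 1`. -/
theorem qdqBellman_contraction {S A : Type*} [MeasurableSpace S] [MeasurableSpace A]
    [Nonempty S] [Nonempty A]
    (r : S × A → ℝ) (γ : ℝ) (hγ : γ ∈ Set.Ioo (0 : ℝ) 1)
    (κ : Kernel (S × A) S) [IsMarkovKernel κ]
    (α β : ℝ) (hα : α ∈ Set.Icc (0 : ℝ) 1) (hβ : β ∈ Set.Icc (0 : ℝ) 1)
    (U : Set (S × A)) (H : S × A → ℝ)
    (hH : ∀ x ∈ U, 0 < H x) (hβH : ∀ x ∈ U, 1 ≤ β * H x)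
    (Q Q' : S × A → ℝ) (M : ℝ) (hQ : ∀ x, |Q x| ≤ M) (hQ' : ∀ x, |Q' x| ≤ M)
    (hint : ∀ p : S × A,
      Integrable (fun s' => ⨆ a' : A, blendedTarget U H α β Q (s', a')) (κ p))
    (hint' : ∀ p : S × A,
      Integrable (fun s' => ⨆ a' : A, blendedTarget U H α β Q' (s', a')) (κ p)) :
    ∀ p : S × A,
      |qdqBellman r γ κ U H α β Q p - qdqBellman r γ κ U H α β Q' p| ≤
        (α + (1 - α) * β) * γ * ⨆ x : S × A, |Q x - Q' x| := by
  intro p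
  have hα' : 0 ≤ 1 - α := sub_nonneg.2 hα.2
  have hα₀ : 0 ≤ α := hα.1
  have hβ₀ : 0 ≤ β := hβ.1
  have hL : 0 ≤ α + (1 - α) * β := by positivity
  have hbdd : ∀ R : S × A → ℝ, (∀ x, |R x| ≤ M) → ∀ s : S,
      BddAbove (Set.range fun a : A => blendedTarget U H α β R (s, a)) := by
    intro R hR s
    refine ⟨(α + (1 - α) * β) * M, ?_⟩
    rintro _ ⟨a, rfl⟩
    exact (le_abs_self _).trans ((abs_blendedTarget_le hα hβ₀ hH hβH R _).trans
      (mul_le_mul_of_nonneg_left (hR _) hL))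
  have hdiff : BddAbove (Set.range fun x : S × A => |Q x - Q' x|) := by
    refine ⟨M + M, ?_⟩
    rintro _ ⟨x, rfl⟩
    exact (abs_sub _ _).trans (add_le_add (hQ x) (hQ' x))
  set D : ℝ := ⨆ x : S × A, |Q x - Q' x|
  have hsup : ∀ s : S, |(⨆ a : A, blendedTarget U H α β Q (s, a)) -
      ⨆ a : A, blendedTarget U H α β Q' (s, a)| ≤ (α + (1 - α) * β) * D := fun s =>
    abs_ciSup_sub_ciSup_le (hbdd Q hQ s) (hbdd Q' hQ' s) fun a =>
      (abs_blendedTarget_sub_le hα hβ₀ hH hβH Q Q' (s, a)).trans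
        (mul_le_mul_of_nonneg_left (le_ciSup hdiff (s, a)) hL)
  have hI := norm_integral_le_of_norm_le_const (μ := κ p)
    (f := fun s => (⨆ a : A, blendedTarget U H α β Q (s, a)) -
      ⨆ a : A, blendedTarget U H α β Q' (s, a))
    (Filter.Eventually.of_forall hsup)
  rw [integral_sub (hint p) (hint' p), probReal_univ, mul_one, Real.norm_eq_abs] at hI
  rw [qdqBellman, qdqBellman, add_sub_add_left_eq_sub, ← mul_sub, abs_mul, abs_of_pos hγ.1]
  calc _ ≤ γ * ((α + (1 - α) * β) * D) := mul_le_mul_of_nonneg_left hI hγ.1.le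
    _ = (α + (1 - α) * β) * γ * D := by ring
end
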